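/- Decompose ℝⁿ = ℝ^{n₁} × ⋯ × ℝ^{n_k} with n₁ + ⋯ + n_k = n and each nᵢ ≥ 1, and let a, b ∈ ℝᵏ with 0 < aᵢ ≤ bᵢ < ∞ for all i. For every f ∈ L¹(ℝⁿ) one has ‖M̃_a^b f‖_{L¹(ℝⁿ)} ≤ (∏_{i=1}^k (1 + nᵢ·ln(bᵢ/aᵢ)))·‖f‖_{L¹(ℝⁿ)}, where M̃_a^b is the general strong truncated Hardy–Littlewood maximal operator. -/

import Mathlib

open MeasureTheory Metric Set ENNReal NNReal

/-- The general strong truncated Hardy–Littlewood maximal operator on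
`ℝⁿ = ℝ^{n₁} × ⋯ × ℝ^{n_k}`:
`M̃_a^b f(x) = sup_{aᵢ ≤ rᵢ ≤ bᵢ} (1/∏ᵢ|B(xᵢ,rᵢ)|) ∫_{∏ᵢ B(xᵢ,rᵢ)} |f(y)| dy`. -/
noncomputable def genTruncMax (k : ℕ) (n : Fin k → ℕ) (a b : Fin k → ℝ)
    (f : (∀ i, EuclideanSpace ℝ (Fin (n i))) → ℝ)
    (x : ∀ i, EuclideanSpace ℝ (Fin (n i))) : ℝ≥0∞ :=
  ⨆ (r : Fin k → ℝ) (_ : ∀ i, r i ∈ Set.Icc (a i) (b i)),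
    (volume (Set.univ.pi fun i => Metric.ball (x i) (r i)))⁻¹ *
      ∫⁻ y in Set.univ.pi fun i => Metric.ball (x i) (r i), (‖f y‖₊ : ℝ≥0∞)

/-- On a finite product space, the Lebesgue integral of a product of functions, each depending on
one coordinate, is the product of the integrals. -/
theorem lintegral_pi_prod_eq_prod {k : ℕ} {E : Fin k → Type*}
    [∀ i, MeasureSpace (E i)] [∀ i, SigmaFinite (volume : Measure (E i))]
    (g : ∀ i, E i → ℝ≥0∞) (hg : ∀ i, Measurable (g i)) :
    ∫⁻ x : ∀ i, E i, ∏ i, g i (x i) = ∏ i, ∫⁻ z, g i z := by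
  induction k with
  | zero => simp [volume_pi]
  | succ k ih =>
    calc
      _ = ∫⁻ x : E 0 × (∀ i : Fin k, E i.succ), g 0 x.1 * ∏ i : Fin k, g i.succ (x.2 i) := by
        have e := (volume_preserving_piFinSuccAbove E 0).symm
        rw [← e.lintegral_comp_emb (MeasurableEquiv.measurableEmbedding _)]
        simp_rw [MeasurableEquiv.piFinSuccAbove_symm_apply, Fin.insertNthEquiv,
          Fin.prod_univ_succ, Fin.insertNth_zero]
        rfl
      _ = (∫⁻ z, g 0 z) * ∫⁻ x : ∀ i : Fin k, E i.succ, ∏ i, g i.succ (x i) := by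
        refine lintegral_prod_mul (μ := (volume : Measure (E 0)))
          (ν := (volume : Measure (∀ i : Fin k, E i.succ)))
          (g := fun w => ∏ i : Fin k, g i.succ (w i)) (hg 0).aemeasurable ?_
        exact (Finset.measurable_fun_prod _ fun i _ =>
          (hg i.succ).comp (measurable_pi_apply i)).aemeasurable
      _ = ∏ i, ∫⁻ z, g i z := by
        rw [ih _ fun i => hg i.succ, Fin.prod_univ_succ]

/-- Young's inequality `‖K ∗ f‖₁ ≤ ‖K‖₁ ‖f‖₁` for nonnegative functions, as an equality. -/
theorem lintegral_lintegral_sub_mul {G : Type*} [AddGroup G] [MeasurableSpace G]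
    [MeasurableAdd₂ G] [MeasurableNeg G] (μ : Measure G) [SFinite μ] [μ.IsAddRightInvariant]
    {K g : G → ℝ≥0∞} (hK : Measurable K) (hg : AEMeasurable g μ) :
    ∫⁻ x, ∫⁻ y, K (x - y) * g y ∂μ ∂μ = (∫⁻ x, K x ∂μ) * ∫⁻ y, g y ∂μ := by
  rw [lintegral_lintegral_swap
    (((hK.comp (measurable_fst.sub measurable_snd)).aemeasurable).mul hg.comp_snd)]
  have key (y : G) : ∫⁻ x, K (x - y) * g y ∂μ = (∫⁻ x, K x ∂μ) * g y := by
    have h : Measurable fun x => K (x - y) := hK.comp (measurable_id.sub_const y)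
    rw [lintegral_mul_const _ h, lintegral_sub_right_eq_self K y]
  simp_rw [key]
  exact lintegral_const_mul'' _ hg

/-- The function `t ↦ (max a t)⁻ᵈ`, cut off at `b`. -/
noncomputable def truncProfile (d : ℕ) (a b t : ℝ) : ℝ :=
  (Iio b).indicator (fun t => (max a t ^ d)⁻¹) t

theorem truncProfile_nonneg (d : ℕ) {a : ℝ} (ha : 0 < a) (b t : ℝ) :
    0 ≤ truncProfile d a b t := by
  refine Set.indicator_nonneg (fun t _ => ?_) t
  have : 0 < max a t := lt_max_of_lt_left ha
  positivity

theorem measurable_truncProfile (d : ℕ) (a b : ℝ) : Measurable (truncProfile d a b) :=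
  (((measurable_const.max measurable_id).pow_const d).inv).indicator measurableSet_Iio

theorem continuous_pow_mul_inv_max_pow (m d : ℕ) {a : ℝ} (ha : 0 < a) :
    Continuous fun t : ℝ => t ^ m * (max a t ^ d)⁻¹ := by
  refine (continuous_pow m).mul (((continuous_const.max continuous_id).pow d).inv₀ fun t => ?_)
  have : 0 < max a t := lt_max_of_lt_left ha
  exact (pow_pos this d).ne'

theorem pow_smul_truncProfile (m d : ℕ) (a b : ℝ) :
    (fun t : ℝ => t ^ m • truncProfile d a b t) =
      (Iio b).indicator fun t => t ^ m * (max a t ^ d)⁻¹ := by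
  ext t
  by_cases ht : t ∈ Iio b <;> simp [truncProfile, ht]

theorem integrableOn_pow_smul_truncProfile (m d : ℕ) {a : ℝ} (ha : 0 < a) (b : ℝ) :
    IntegrableOn (fun t : ℝ => t ^ m • truncProfile d a b t) (Ioi 0) := by
  rw [pow_smul_truncProfile, IntegrableOn, integrable_indicator_iff measurableSet_Iio,
    IntegrableOn, Measure.restrict_restrict measurableSet_Iio, inter_comm, Ioi_inter_Iio]
  exact ((continuous_pow_mul_inv_max_pow m d ha).integrableOn_Icc (a := 0) (b := b)).mono_set
    Ioo_subset_Icc_self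

theorem integral_pow_smul_truncProfile {d : ℕ} (hd : 1 ≤ d) {a b : ℝ} (ha : 0 < a)
    (hab : a ≤ b) :
    ∫ t in Ioi (0 : ℝ), t ^ (d - 1) • truncProfile d a b t = (d : ℝ)⁻¹ + Real.log (b / a) := by
  have hd' : (d : ℝ) ≠ 0 := by positivity
  have hcont := continuous_pow_mul_inv_max_pow (d - 1) d ha
  have hzero : ∫ t in (0 : ℝ)..a, t ^ (d - 1) * (max a t ^ d)⁻¹ = (d : ℝ)⁻¹ := by
    have h : EqOn (fun t : ℝ => t ^ (d - 1) * (max a t ^ d)⁻¹)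
        (fun t => t ^ (d - 1) * (a ^ d)⁻¹) (uIcc 0 a) := by
      intro t ht
      rw [uIcc_of_le ha.le] at ht
      simp only [max_eq_left ht.2]
    rw [intervalIntegral.integral_congr h, intervalIntegral.integral_mul_const, integral_pow,
      ← Nat.cast_add_one, Nat.sub_add_cancel hd, zero_pow (by lia)]
    field_simp
    simp
  have htail : ∫ t in a..b, t ^ (d - 1) * (max a t ^ d)⁻¹ = Real.log (b / a) := by
    have h : EqOn (fun t : ℝ => t ^ (d - 1) * (max a t ^ d)⁻¹) (fun t => t⁻¹) (uIcc a b) := by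
      intro t ht
      rw [uIcc_of_le hab] at ht
      have ht' : 0 < t := ha.trans_le ht.1
      obtain ⟨e, rfl⟩ := Nat.exists_eq_add_of_le' hd
      simp only [max_eq_right ht.1, Nat.add_sub_cancel, pow_succ]
      field_simp
    rw [intervalIntegral.integral_congr h, integral_inv_of_pos ha (ha.trans_le hab)]
  rw [pow_smul_truncProfile, setIntegral_indicator measurableSet_Iio, Ioi_inter_Iio,
    ← integral_Ioc_eq_integral_Ioo, ← intervalIntegral.integral_of_le (ha.le.trans hab),
    ← intervalIntegral.integral_add_adjacent_intervals (hcont.intervalIntegrable 0 a)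
      (hcont.intervalIntegrable a b), hzero, htail]

section TruncKernel

variable {E : Type*} [NormedAddCommGroup E] [InnerProductSpace ℝ E] [FiniteDimensional ℝ E]
  [MeasurableSpace E] [BorelSpace E]

/-- The radial kernel `z ↦ |B(0, max(a, ‖z‖))|⁻¹`, cut off at `‖z‖ = b`. -/
noncomputable def truncKernel (a b : ℝ) (z : E) : ℝ≥0∞ :=
  ENNReal.ofReal ((volume.real (ball (0 : E) 1))⁻¹ *
    truncProfile (Module.finrank ℝ E) a b ‖z‖)

theorem measurable_truncKernel (a b : ℝ) : Measurable (truncKernel a b : E → ℝ≥0∞) :=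
  (((measurable_truncProfile _ a b).comp measurable_norm).const_mul _).ennreal_ofReal

theorem lintegral_truncKernel (hd : 1 ≤ Module.finrank ℝ E) {a b : ℝ} (ha : 0 < a)
    (hab : a ≤ b) :
    ∫⁻ z : E, truncKernel a b z =
      ENNReal.ofReal (1 + (Module.finrank ℝ E : ℝ) * Real.log (b / a)) := by
  have : Nontrivial E := Module.nontrivial_of_finrank_pos (R := ℝ) hd
  have hω : 0 < volume.real (ball (0 : E) 1) :=
    ENNReal.toReal_pos (measure_ball_pos volume _ one_pos).ne' measure_ball_lt_top.ne
  have hint : Integrable (fun z : E => truncProfile (Module.finrank ℝ E) a b ‖z‖) :=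
    (integrable_fun_norm_addHaar volume).2 (integrableOn_pow_smul_truncProfile _ _ ha b)
  have hnn (z : E) := truncProfile_nonneg (Module.finrank ℝ E) ha b ‖z‖
  have hd' : (Module.finrank ℝ E : ℝ) ≠ 0 := by positivity
  simp only [truncKernel]
  rw [← ofReal_integral_eq_lintegral_ofReal (hint.const_mul _)
      (Filter.Eventually.of_forall fun z => mul_nonneg (inv_nonneg.2 hω.le) (hnn z)),
    integral_const_mul, integral_fun_norm_addHaar, integral_pow_smul_truncProfile hd ha hab]
  congr 1
  simp only [nsmul_eq_mul, smul_eq_mul]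
  field_simp

theorem inv_volume_ball_le_truncKernel {a b r : ℝ} (ha : 0 < a) (hr : r ∈ Icc a b) {x y : E}
    (hy : y ∈ ball x r) : (volume (ball x r))⁻¹ ≤ truncKernel a b (x - y) := by
  have hr0 : 0 < r := ha.trans_le hr.1
  have hω : 0 < volume.real (ball (0 : E) 1) :=
    ENNReal.toReal_pos (measure_ball_pos volume _ one_pos).ne' measure_ball_lt_top.ne
  have hxy : ‖x - y‖ < r := by rwa [← dist_eq_norm, dist_comm]
  have hmax : 0 < max a ‖x - y‖ := lt_max_of_lt_left ha
  have hpow : 0 < r ^ Module.finrank ℝ E := pow_pos hr0 _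
  rw [Measure.addHaar_ball_of_pos _ _ hr0, ← ofReal_measureReal measure_ball_lt_top.ne,
    ← ENNReal.ofReal_mul hpow.le, ← ENNReal.ofReal_inv_of_pos (mul_pos hpow hω), truncKernel,
    truncProfile, indicator_of_mem (show ‖x - y‖ ∈ Iio b from hxy.trans_le hr.2), mul_inv,
    mul_comm]
  refine ENNReal.ofReal_le_ofReal ?_
  gcongr
  exact max_le hr.1 hxy.le

end TruncKernel

theorem genTruncMax_le_lintegral (k : ℕ) (n : Fin k → ℕ) {a b : Fin k → ℝ} (ha : ∀ i, 0 < a i)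
    (f : (∀ i, EuclideanSpace ℝ (Fin (n i))) → ℝ) (x : ∀ i, EuclideanSpace ℝ (Fin (n i))) :
    genTruncMax k n a b f x ≤
      ∫⁻ y, (∏ i, truncKernel (a i) (b i) ((x - y) i)) * (‖f y‖₊ : ℝ≥0∞) := by
  refine iSup₂_le fun r hr => ?_
  have hr0 (i) : 0 < r i := (ha i).trans_le (hr i).1
  have hvol : (volume (univ.pi fun i => ball (x i) (r i)))⁻¹ =
      ∏ i, (volume (ball (x i) (r i)))⁻¹ := by
    rw [volume_pi_pi]
    exact ENNReal.prod_inv_distrib fun i _ j _ _ =>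
      Or.inl (measure_ball_pos volume (x i) (hr0 i)).ne'
  have htop : (volume (univ.pi fun i => ball (x i) (r i)))⁻¹ ≠ ∞ := by
    rw [hvol]
    exact ENNReal.prod_ne_top fun i _ =>
      ENNReal.inv_ne_top.2 (measure_ball_pos volume _ (hr0 i)).ne'
  rw [← lintegral_const_mul' _ _ htop, hvol]
  refine (setLIntegral_mono' (MeasurableSet.univ_pi fun i => measurableSet_ball)
    fun y hy => ?_).trans (setLIntegral_le_lintegral _ _)
  refine mul_le_mul_left (Finset.prod_le_prod' fun i _ => ?_) _
  exact inv_volume_ball_le_truncKernel (ha i) (hr i) (hy i (mem_univ i))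

/-- For `0 < aᵢ ≤ bᵢ < ∞`, the general strong truncated Hardy–Littlewood maximal
operator is bounded on `L¹(ℝⁿ)` with norm at most `∏ᵢ (1 + nᵢ·ln(bᵢ/aᵢ))`. -/
theorem genTruncMax_l1_bound (k : ℕ) (hk : 1 ≤ k) (n : Fin k → ℕ) (hn : ∀ i, 1 ≤ n i)
    (a b : Fin k → ℝ) (ha : ∀ i, 0 < a i) (hab : ∀ i, a i ≤ b i)
    (f : (∀ i, EuclideanSpace ℝ (Fin (n i))) → ℝ) (hf : Integrable f) :
    ∫⁻ x, genTruncMax k n a b f x ≤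
      ENNReal.ofReal (∏ i, (1 + (n i : ℝ) * Real.log (b i / a i))) *
        ∫⁻ x, (‖f x‖₊ : ℝ≥0∞) := by
  have hmeas (i : Fin k) := measurable_truncKernel (E := EuclideanSpace ℝ (Fin (n i))) (a i) (b i)
  have hlog (i : Fin k) : 0 ≤ Real.log (b i / a i) :=
    Real.log_nonneg ((one_le_div (ha i)).2 (hab i))
  have hK : Measurable fun x : ∀ i, EuclideanSpace ℝ (Fin (n i)) =>
      ∏ i, truncKernel (a i) (b i) (x i) :=
    Finset.measurable_fun_prod _ fun i _ => (hmeas i).comp (measurable_pi_apply i)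
  have hf' : AEMeasurable fun y => (‖f y‖₊ : ℝ≥0∞) := hf.1.aemeasurable.nnnorm.coe_nnreal_ennreal
  calc
    ∫⁻ x, genTruncMax k n a b f x
      ≤ ∫⁻ x, ∫⁻ y, (∏ i, truncKernel (a i) (b i) ((x - y) i)) * (‖f y‖₊ : ℝ≥0∞) :=
        lintegral_mono fun x => genTruncMax_le_lintegral k n ha f x
    _ = (∫⁻ x : ∀ i, EuclideanSpace ℝ (Fin (n i)), ∏ i, truncKernel (a i) (b i) (x i)) *
          ∫⁻ x, (‖f x‖₊ : ℝ≥0∞) :=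
        lintegral_lintegral_sub_mul volume hK hf'
    _ = (∏ i, ENNReal.ofReal (1 + (n i : ℝ) * Real.log (b i / a i))) *
          ∫⁻ x, (‖f x‖₊ : ℝ≥0∞) := by
        rw [lintegral_pi_prod_eq_prod _ hmeas]
        congr 1
        refine Finset.prod_congr rfl fun i _ => ?_
        rw [lintegral_truncKernel (by simpa using hn i) (ha i) (hab i), finrank_euclideanSpace_fin]
    _ = _ := by
        rw [ENNReal.ofReal_prod_of_nonneg fun i _ =>
          add_nonneg zero_le_one (mul_nonneg (Nat.cast_nonneg _) (hlog i))]
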